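/- arXiv:2210.09793 — 4 statements merged into one kernel-verified Lean document; each statement's English description precedes it below -/
import Mathlib

section
/- Let β ∈ (1/2,1), a ∈ (0,π), A = arcsin((β/(2−β)) sin a), and w = A + a (so 0 < w < π). Then for any real d, γ with d + γ > 0: 1 − ((β/2)cos a + (1 − β/2)cos A)^{d+γ} ≤ 4 · max{1, d+γ} · sin²(w/2). In fact the exact identity 1 − ((β/2)cos a + (1 − β/2)cos A) = β sin²(a/2) + (2−β) sin²(A/2) holds, and sin²(a/2) + sin²(A/2) ≤ 2 sin²(w/2). -/
/-- Well-definedness bound in the Cancellation Lemma for the inelastic model: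
with `A = arcsin ((β/(2−β)) sin a)` and `w = A + a`,
`1 − ((β/2) cos a + (1 − β/2) cos A)^(d+γ) ≤ 4 max{1, d+γ} sin²(w/2)`,
together with the exact identity
`1 − ((β/2) cos a + (1 − β/2) cos A) = β sin²(a/2) + (2−β) sin²(A/2)`
and `sin²(a/2) + sin²(A/2) ≤ 2 sin²(w/2)`. -/
theorem inelastic_cancellation_bound (β a A w : ℝ)
    (hβ : β ∈ Set.Ioo (1/2 : ℝ) 1) (ha : a ∈ Set.Ioo 0 Real.pi)
    (hA : A = Real.arcsin ((β/(2 - β)) * Real.sin a)) (hw : w = A + a) :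
    (∀ d γ : ℝ, 0 < d + γ →
      1 - ((β/2) * Real.cos a + (1 - β/2) * Real.cos A) ^ (d + γ)
        ≤ 4 * max 1 (d + γ) * (Real.sin (w/2))^2) ∧
    1 - ((β/2) * Real.cos a + (1 - β/2) * Real.cos A)
      = β * (Real.sin (a/2))^2 + (2 - β) * (Real.sin (A/2))^2 ∧
    (Real.sin (a/2))^2 + (Real.sin (A/2))^2 ≤ 2 * (Real.sin (w/2))^2 := by
  obtain ⟨hb1, hb2⟩ := hβ
  obtain ⟨ha1, ha2⟩ := ha
  have hs : 0 < Real.sin a := Real.sin_pos_of_pos_of_lt_pi ha1 ha2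
  have hs1 : Real.sin a ≤ 1 := Real.sin_le_one a
  have h2 : 0 < 2 - β := by linarith
  have hk0 : 0 < β / (2 - β) := by apply div_pos <;> linarith
  have hk1 : β / (2 - β) < 1 := by rw [div_lt_one h2]; linarith
  have hks : β / (2 - β) * Real.sin a < Real.sin a := by nlinarith
  have hks0 : 0 < β / (2 - β) * Real.sin a := mul_pos hk0 hs
  have hsA : Real.sin A = β / (2 - β) * Real.sin a := by
    rw [hA]; exact Real.sin_arcsin (by linarith) (by linarith)
  have hA0 : 0 < A := by rw [hA]; exact Real.arcsin_pos.2 hks0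
  have hA2 : A ≤ Real.pi / 2 := by rw [hA]; exact Real.arcsin_le_pi_div_two _
  have hAa : A < a := by
    by_contra! h
    have := Real.sin_le_sin_of_le_of_le_pi_div_two (by linarith) hA2 h
    linarith
  have hApa : A < Real.pi - a := by
    by_contra! h
    have := Real.sin_le_sin_of_le_of_le_pi_div_two (by linarith) hA2 h
    rw [Real.sin_pi_sub] at this
    linarith
  have e1 : Real.sin (a/2) ≤ Real.sin (w/2) :=
    Real.sin_le_sin_of_le_of_le_pi_div_two (by linarith) (by linarith) (by linarith)
  have e2 : Real.sin (A/2) ≤ Real.sin (w/2) :=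
    Real.sin_le_sin_of_le_of_le_pi_div_two (by linarith) (by linarith) (by linarith)
  have p1 : 0 ≤ Real.sin (a/2) :=
    Real.sin_nonneg_of_nonneg_of_le_pi (by linarith) (by linarith)
  have p2 : 0 ≤ Real.sin (A/2) :=
    Real.sin_nonneg_of_nonneg_of_le_pi (by linarith) (by linarith)
  have q1 := pow_le_pow_left₀ p1 e1 2
  have q2 := pow_le_pow_left₀ p2 e2 2
  have half : ∀ x : ℝ, Real.cos x = 1 - 2 * Real.sin (x/2) ^ 2 := by
    intro x
    have h := Real.cos_two_mul (x/2)
    rw [show 2 * (x/2) = x by ring] at h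
    have := Real.sin_sq_add_cos_sq (x/2)
    linarith
  have hid : 1 - ((β/2) * Real.cos a + (1 - β/2) * Real.cos A)
      = β * (Real.sin (a/2))^2 + (2 - β) * (Real.sin (A/2))^2 := by
    rw [half a, half A]; ring
  refine ⟨?_, hid, by linarith⟩
  intro d γ hp
  have hcA : 0 ≤ Real.cos A := Real.cos_nonneg_of_neg_pi_div_two_le_of_le (by linarith) hA2
  have hX0 : 0 < (β/2) * Real.cos a + (1 - β/2) * Real.cos A := by
    have hsA' : (2 - β) * Real.sin A = β * Real.sin a := by
      rw [hsA]; field_simp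
    have c1 := Real.sin_sq_add_cos_sq a
    have c2 := Real.sin_sq_add_cos_sq A
    have h3 : (β * Real.cos a)^2 < ((2 - β) * Real.cos A)^2 := by
      have u1 : (β * Real.cos a)^2 = β^2 - (β * Real.sin a)^2 := by
        linear_combination β^2 * c1
      have u2 : ((2 - β) * Real.cos A)^2 = (2-β)^2 - ((2-β) * Real.sin A)^2 := by
        linear_combination (2-β)^2 * c2
      rw [u1, u2, hsA']; nlinarith
    have := (abs_lt_of_sq_lt_sq h3 (mul_nonneg h2.le hcA))
    have := (abs_lt.1 this).1
    linarith
  have hXle : 1 - ((β/2) * Real.cos a + (1 - β/2) * Real.cos A) ≤ 4 * Real.sin (w/2)^2 := by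
    rw [hid]
    nlinarith [sq_nonneg (Real.sin (a/2)), sq_nonneg (Real.sin (A/2))]
  have hX1 : (β/2) * Real.cos a + (1 - β/2) * Real.cos A ≤ 1 := by
    nlinarith [Real.cos_le_one a, Real.cos_le_one A]
  generalize (β/2) * Real.cos a + (1 - β/2) * Real.cos A = X at *
  generalize d + γ = p at *
  have key : 1 - X ^ p ≤ max 1 p * (1 - X) := by
    rcases le_total p 1 with h | h
    · rw [max_eq_left h]
      have := Real.rpow_le_rpow_of_exponent_ge hX0 hX1 h
      rw [Real.rpow_one] at this
      linarith
    · rw [max_eq_right h]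
      have := one_add_mul_self_le_rpow_one_add (s := X - 1) (by linarith) h
      rw [show 1 + (X - 1) = X by ring] at this
      linarith
  have hm : 0 ≤ max 1 p := le_trans zero_le_one (le_max_left _ _)
  nlinarith [mul_le_mul_of_nonneg_left hXle hm]
end

section
/- Let d ≥ 2, let 0 < m_i < m_j, let v, v_* ∈ ℝ^d with v ≠ v_*, and let σ be a unit vector with σ ≠ ±(v−v_*)/|v−v_*|. Define v_*' = (m_i/(m_i+m_j))v + (m_j/(m_i+m_j))v_* − (m_i/(m_i+m_j))|v−v_*|σ (so v_*' ≠ v), and the angles a = arccos(⟨(v−v_*)/|v−v_*|, σ⟩) and b = arccos(⟨(v−v_*')/|v−v_*'|, σ⟩), both in (0,π). Then the law of sines holds: (m_j/(m_i+m_j))|v−v_*| sin a = |v−v_*'| sin b and (m_i/(m_i+m_j))|v−v_*| sin a = |v−v_*'| sin(a−b); in particular 0 < a − b < π/2 and sin(a−b) = (m_i/m_j) sin b. -/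
open RealInnerProductSpace

set_option maxHeartbeats 1000000

/-- Law of sines for the mixture collision triangle `(v, v_*, v_*')` (case `m_i < m_j`):
with `a` the angle `cos a = ⟨(v−v_*)/|v−v_*|, σ⟩` and `b` the angle
`cos b = ⟨(v−v_*')/|v−v_*'|, σ⟩`, one has
`(m_j/(m_i+m_j))|v−v_*| sin a = |v−v_*'| sin b`,
`(m_i/(m_i+m_j))|v−v_*| sin a = |v−v_*'| sin (a−b)`, `0 < a − b < π/2` and
`sin (a−b) = (m_i/m_j) sin b`. -/
theorem mixture_law_of_sines (d : ℕ) (hd : 2 ≤ d)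
    (mi mj : ℝ) (hmi : 0 < mi) (hij : mi < mj)
    (v vs σ : EuclideanSpace ℝ (Fin d)) (hσ : ‖σ‖ = 1) (hne : v ≠ vs)
    (hσ1 : σ ≠ (‖v - vs‖⁻¹) • (v - vs)) (hσ2 : σ ≠ -((‖v - vs‖⁻¹) • (v - vs)))
    (vs' : EuclideanSpace ℝ (Fin d)) (a b : ℝ)
    (hvs' : vs' = (mi/(mi+mj)) • v + (mj/(mi+mj)) • vs
        - ((mi/(mi+mj)) * ‖v - vs‖) • σ)
    (ha : a = Real.arccos ⟪(‖v - vs‖⁻¹) • (v - vs), σ⟫)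
    (hb : b = Real.arccos ⟪(‖v - vs'‖⁻¹) • (v - vs'), σ⟫) :
    (mj/(mi+mj)) * ‖v - vs‖ * Real.sin a = ‖v - vs'‖ * Real.sin b ∧
    (mi/(mi+mj)) * ‖v - vs‖ * Real.sin a = ‖v - vs'‖ * Real.sin (a - b) ∧
    (0 < a - b ∧ a - b < Real.pi/2) ∧
    Real.sin (a - b) = (mi/mj) * Real.sin b := by
  have hr : 0 < ‖v - vs‖ := norm_pos_iff.mpr (sub_ne_zero.mpr hne)
  have hmj : 0 < mj := hmi.trans hij
  have hs : 0 < mi + mj := by linarith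
  obtain ⟨r, hrd⟩ : ∃ r, r = ‖v - vs‖ := ⟨_, rfl⟩
  obtain ⟨n, hn⟩ : ∃ n, n = (‖v - vs‖⁻¹) • (v - vs) := ⟨_, rfl⟩
  obtain ⟨p, hp⟩ : ∃ p, p = mi/(mi+mj) := ⟨_, rfl⟩
  obtain ⟨q, hq⟩ : ∃ q, q = mj/(mi+mj) := ⟨_, rfl⟩
  have hpq : p + q = 1 := by rw [hp, hq]; field_simp
  have hp0 : 0 < p := by rw [hp]; positivity
  have hplt : p < q := by rw [hp, hq]; gcongr
  have hmm : mi / mj = p / q := by rw [hp, hq]; field_simp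
  have hn1 : ‖n‖ = 1 := by
    rw [hn, norm_smul, norm_inv, norm_norm]; field_simp
  have hvn : v - vs = r • n := by
    rw [hn, hrd, smul_smul, mul_inv_cancel₀ hr.ne', one_smul]
  rw [← hn] at hσ1 hσ2 ha
  rw [← hp, ← hq, ← hrd] at hvs'
  rw [← hp, ← hq, ← hrd]
  have hr0 : 0 < r := by rw [hrd]; exact hr
  have hw : v - vs' = (r * q) • n + (r * p) • σ := by
    have h1 : v - vs' = q • (v - vs) + (p * r) • σ := by
      rw [hvs']
      have : p = 1 - q := by linarith
      rw [this]; module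
    rw [h1, hvn]; module
  obtain ⟨c, hc⟩ : ∃ c, c = ⟪n, σ⟫ := ⟨_, rfl⟩
  have hc1 : c < 1 := by
    rw [hc]; exact (inner_lt_one_iff_real_of_norm_eq_one hn1 hσ).mpr (Ne.symm hσ1)
  have hc2 : -1 < c := by
    have h := (inner_lt_one_iff_real_of_norm_eq_one (x := -n) (y := σ)
      (by rw [norm_neg, hn1]) hσ).mpr (Ne.symm hσ2)
    rw [inner_neg_left, ← hc] at h; linarith
  rw [← hc] at ha
  obtain ⟨R, hR⟩ : ∃ R, R = ‖v - vs'‖ := ⟨_, rfl⟩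
  have hσσ : ⟪σ, σ⟫ = (1:ℝ) := by rw [real_inner_self_eq_norm_sq, hσ]; norm_num
  have hnn : ⟪n, n⟫ = (1:ℝ) := by rw [real_inner_self_eq_norm_sq, hn1]; norm_num
  have hσn : ⟪σ, n⟫ = c := by rw [real_inner_comm, hc]
  have hwσ : ⟪v - vs', σ⟫ = r * (q * c + p) := by
    rw [hw, inner_add_left, real_inner_smul_left, real_inner_smul_left, hσσ, ← hc]; ring
  have hR2 : R ^ 2 = r ^ 2 * (q ^ 2 + p ^ 2 + 2 * p * q * c) := by
    rw [hR, ← real_inner_self_eq_norm_sq, hw]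
    simp only [inner_add_left, inner_add_right, real_inner_smul_left, real_inner_smul_right,
      hσσ, hnn, hσn, ← hc]
    ring
  have hq0 : 0 < q := hp0.trans hplt
  have hR0 : 0 < R := by
    have h0 : 0 ≤ R := by rw [hR]; exact norm_nonneg _
    have : 0 < R ^ 2 := by
      rw [hR2]
      have : 0 < p * q * (1 + c) := by
        have : 0 < 1 + c := by linarith
        positivity
      have : 0 < q ^ 2 + p ^ 2 + 2 * p * q * c := by linarith [sq_nonneg (q - p)]
      positivity
    exact lt_of_le_of_ne h0 (by rintro rfl; norm_num at this)
  have hca : Real.cos a = c := by rw [ha, Real.cos_arccos hc2.le hc1.le]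
  have hcb : R * Real.cos b = r * (q * c + p) := by
    have habs := abs_real_inner_le_norm (v - vs') σ
    rw [hσ, mul_one, ← hR, abs_le] at habs
    rw [hb, ← hR, real_inner_smul_left, Real.cos_arccos, ← hwσ]
    · field_simp
    · rw [inv_mul_eq_div, le_div_iff₀ hR0]; linarith
    · rw [inv_mul_eq_div, div_le_iff₀ hR0]; linarith
  have ha0 : 0 < a := by rw [ha]; exact Real.arccos_pos.mpr hc1
  have haπ : a < Real.pi := by
    rw [ha]
    refine lt_of_le_of_ne (Real.arccos_le_pi c) fun h => ?_
    rw [Real.arccos_eq_pi] at h; linarith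
  have hb0 : 0 ≤ b := by rw [hb]; exact Real.arccos_nonneg _
  have hbπ : b ≤ Real.pi := by rw [hb]; exact Real.arccos_le_pi _
  have hsa : 0 < Real.sin a := Real.sin_pos_of_pos_of_lt_pi ha0 haπ
  have hsb : 0 ≤ Real.sin b := Real.sin_nonneg_of_nonneg_of_le_pi hb0 hbπ
  have hA := Real.sin_sq_add_cos_sq a
  have hB := Real.sin_sq_add_cos_sq b
  rw [hca] at hA
  have e1 : q * r * Real.sin a = R * Real.sin b := by
    have h : (q * r * Real.sin a) ^ 2 = (R * Real.sin b) ^ 2 := by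
      have h2 : (R * Real.sin b) ^ 2 = R ^ 2 - (R * Real.cos b) ^ 2 := by
        linear_combination R ^ 2 * hB
      rw [h2, hcb, hR2]
      linear_combination q ^ 2 * r ^ 2 * hA
    exact (pow_left_inj₀ (by positivity) (by positivity) two_ne_zero).mp h
  have e2 : p * r * Real.sin a = R * Real.sin (a - b) := by
    rw [Real.sin_sub, hca]
    linear_combination -c * e1 - Real.sin a * hcb
  have e3 : R * Real.cos (a - b) = r * (q + p * c) := by
    rw [Real.cos_sub, hca]
    linear_combination c * hcb - Real.sin a * e1 + r * q * hA
  have hsin : 0 < Real.sin (a - b) := by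
    have : 0 < R * Real.sin (a - b) := by rw [← e2]; positivity
    exact pos_of_mul_pos_right this hR0.le
  have hcos : 0 < Real.cos (a - b) := by
    have : 0 < R * Real.cos (a - b) := by
      rw [e3]
      have h1 : 0 < p * (1 + c) := mul_pos hp0 (by linarith)
      have : 0 < q + p * c := by linarith
      positivity
    exact pos_of_mul_pos_right this hR0.le
  rw [← hR]
  refine ⟨e1, e2, ⟨?_, ?_⟩, ?_⟩
  · by_contra! h
    have := Real.sin_nonpos_of_nonpos_of_neg_pi_le h (by linarith)
    linarith
  · by_contra! h
    have := Real.cos_nonpos_of_pi_div_two_le_of_le h (by linarith [Real.pi_pos])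
    linarith
  · rw [hmm]
    have : R * (q * Real.sin (a - b)) = R * (p * Real.sin b) := by
      linear_combination p * e1 - q * e2
    have := mul_left_cancel₀ hR0.ne' this
    field_simp
    linarith
end

section
/- Let d ≥ 2, let 0 < m_i < m_j, let v ∈ ℝ^d, and let σ be a unit vector. Define Φ : ℝ^d → ℝ^d by Φ(v_*) = (m_i/(m_i+m_j))v + (m_j/(m_i+m_j))v_* − (m_i/(m_i+m_j))|v−v_*|σ. Then at every v_* ≠ v the map Φ is differentiable, and the determinant of its Fréchet derivative equals (m_j/(m_i+m_j))^d · (1 + (m_i/m_j)⟨(v−v_*)/|v−v_*|, σ⟩); in particular this determinant is strictly positive. -/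
open RealInnerProductSpace

/-- Jacobian of the change of variables `v_* ↦ v_*'` in the Cancellation Lemma for
the mixture model (case `m_i < m_j`): the map
`Φ(v_*) = (m_i/(m_i+m_j)) v + (m_j/(m_i+m_j)) v_* − (m_i/(m_i+m_j))|v−v_*| σ`
is differentiable at every `v_* ≠ v`, with Jacobian determinant
`(m_j/(m_i+m_j))^d (1 + (m_i/m_j) ⟨(v−v_*)/|v−v_*|, σ⟩) > 0`. -/
theorem mixture_jacobian (d : ℕ) (hd : 2 ≤ d)
    (mi mj : ℝ) (hmi : 0 < mi) (hij : mi < mj)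
    (v σ : EuclideanSpace ℝ (Fin d)) (hσ : ‖σ‖ = 1)
    (Φ : EuclideanSpace ℝ (Fin d) → EuclideanSpace ℝ (Fin d))
    (hΦ : ∀ vs, Φ vs = (mi/(mi+mj)) • v + (mj/(mi+mj)) • vs
        - ((mi/(mi+mj)) * ‖v - vs‖) • σ) :
    ∀ vs : EuclideanSpace ℝ (Fin d), vs ≠ v →
      DifferentiableAt ℝ Φ vs ∧
      (fderiv ℝ Φ vs).det
        = (mj/(mi+mj))^d * (1 + (mi/mj) * ⟪(‖v - vs‖⁻¹) • (v - vs), σ⟫) ∧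
      0 < (fderiv ℝ Φ vs).det := by
  intro vs hvs
  have hmj : 0 < mj := hmi.trans hij
  have hne : v - vs ≠ 0 := sub_ne_zero.mpr (Ne.symm hvs)
  have hn : 0 < ‖v - vs‖ := norm_pos_iff.mpr hne
  have hsub : HasFDerivAt (fun x : EuclideanSpace ℝ (Fin d) => v - x)
      (-ContinuousLinearMap.id ℝ (EuclideanSpace ℝ (Fin d))) vs :=
    (hasFDerivAt_id vs).const_sub v
  have hnorm : HasFDerivAt (fun x : EuclideanSpace ℝ (Fin d) => ‖v - x‖)
      (-(‖v - vs‖⁻¹ • innerSL ℝ (v - vs))) vs := by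
    have h := hsub.norm_sq.sqrt (by positivity)
    simp only [Real.sqrt_sq (norm_nonneg _)] at h
    refine h.congr_fderiv ?_
    ext x
    simp
    field_simp
    ring
  set L : EuclideanSpace ℝ (Fin d) →L[ℝ] ℝ := ‖v - vs‖⁻¹ • innerSL ℝ (v - vs) with hL
  have hLs : L σ = ⟪(‖v - vs‖⁻¹) • (v - vs), σ⟫ := by
    simp [hL, inner_smul_left, inner_sub_left]
  have hD : HasFDerivAt Φ ((mj/(mi+mj)) • ContinuousLinearMap.id ℝ (EuclideanSpace ℝ (Fin d))
      - ((mi/(mi+mj)) • (-L)).smulRight σ) vs := by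
    rw [show Φ = _ from funext hΦ]
    exact (((hasFDerivAt_id vs).const_smul (mj/(mi+mj))).const_add _).sub
      ((hnorm.const_mul (mi/(mi+mj))).smul_const σ)
  have hdet : (fderiv ℝ Φ vs).det
        = (mj/(mi+mj))^d * (1 + (mi/mj) * ⟪(‖v - vs‖⁻¹) • (v - vs), σ⟫) := by
    rw [hD.fderiv, ← hLs, ContinuousLinearMap.det]
    have : (((mj/(mi+mj)) • ContinuousLinearMap.id ℝ (EuclideanSpace ℝ (Fin d))
      - ((mi/(mi+mj)) • (-L)).smulRight σ : EuclideanSpace ℝ (Fin d) →L[ℝ] _) :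
        EuclideanSpace ℝ (Fin d) →ₗ[ℝ] EuclideanSpace ℝ (Fin d)) =
        (mj/(mi+mj)) • LinearMap.transvection ((mi/mj) • (L : EuclideanSpace ℝ (Fin d) →ₗ[ℝ] ℝ)) σ := by
      refine LinearMap.ext fun x => ?_
      simp only [LinearMap.smul_apply, LinearMap.transvection.apply, ContinuousLinearMap.coe_coe,
        ContinuousLinearMap.sub_apply, ContinuousLinearMap.smul_apply,
        ContinuousLinearMap.smulRight_apply, ContinuousLinearMap.neg_apply,
        ContinuousLinearMap.id_apply, smul_add, smul_smul, smul_eq_mul]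
      rw [sub_eq_add_neg, ← neg_smul]
      congr 2
      field_simp
    rw [this, LinearMap.det_smul, LinearMap.transvection.det]
    simp
  refine ⟨hD.differentiableAt, hdet, ?_⟩
  rw [hdet]
  have habs : |⟪(‖v - vs‖⁻¹) • (v - vs), σ⟫| ≤ 1 := by
    refine (abs_real_inner_le_norm _ _).trans ?_
    rw [hσ, norm_smul, norm_inv, norm_norm, inv_mul_cancel₀ hn.ne', one_mul]
  have h1 := (abs_le.mp habs).1
  have h2 : mi / mj < 1 := (div_lt_one hmj).mpr hij
  have h3 : 0 < mi / mj := by positivity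
  refine mul_pos (by positivity) ?_
  nlinarith
end

section
/- Let d ≥ 2 and β ∈ (1/2,1). There exists a constant C > 0, depending only on d and β, such that for every R > 0, every ε ∈ (0, 1 − 1/√(1+β²)), and every v ∈ ℝ^d with |v| ≤ √(1+β²)(1−ε)R, one has ∫_{u ∈ B_R(0)} H^{d−1}({v_* ∈ ℝ^d : ⟨v_* − P(u), u − v⟩ = 0 and |v_*| ≤ R}) du ≥ C R^{2d−1} ε^d, where P(u) = (1/β)v − (1/β − 1)u and H^{d−1} denotes (d−1)-dimensional Hausdorff measure (so the inner quantity is the (d−1)-dimensional measure of the portion of the ball B_R(0) lying on the affine hyperplane through P(u) orthogonal to u − v). -/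
open RealInnerProductSpace MeasureTheory

theorem slice_lb (n : ℕ) (w : EuclideanSpace ℝ (Fin (n+1))) (hw : w ≠ 0) (t R ρ : ℝ) (hρ : 0 ≤ ρ)
    (h : |t| + n * ρ ≤ R) :
    ENNReal.ofReal ((2 * ρ) ^ n) ≤ μH[(n:ℝ)] {x : EuclideanSpace ℝ (Fin (n+1)) |
      ⟪x, w⟫ = t * ‖w‖ ∧ ‖x‖ ≤ R} := by
  haveI : Fact (Module.finrank ℝ (EuclideanSpace ℝ (Fin (n+1))) = n + 1) := ⟨by simp⟩
  let b := OrthonormalBasis.fromOrthogonalSpanSingleton (𝕜 := ℝ) n hw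
  have hb : ∀ i, ⟪((b i : (Submodule.span ℝ {w})ᗮ) : EuclideanSpace ℝ (Fin (n+1))), w⟫ = 0 := by
    intro i
    rw [real_inner_comm]
    exact Submodule.mem_orthogonal_singleton_iff_inner_right.1 (b i).2
  have hw' : ‖w‖ ≠ 0 := norm_ne_zero_iff.2 hw
  let L : (Fin n → ℝ) → EuclideanSpace ℝ (Fin (n+1)) := fun a =>
    (t / ‖w‖) • w + ((∑ i, a i • b i : (Submodule.span ℝ {w})ᗮ) : EuclideanSpace ℝ (Fin (n+1)))
  have hL : AntilipschitzWith 1 L := by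
    refine AntilipschitzWith.of_le_mul_dist ?_
    intro x y
    rw [NNReal.coe_one, one_mul, dist_pi_le_iff dist_nonneg]
    intro i
    have e1 : dist (L x) (L y) = ‖∑ i, (x i - y i) • b i‖ := by
      rw [dist_eq_norm]
      simp only [L]
      rw [add_sub_add_left_eq_sub, ← Submodule.coe_sub, Submodule.coe_norm, ← Finset.sum_sub_distrib]
      simp only [sub_smul]
    have e2 : x i - y i = ⟪b i, ∑ i, (x i - y i) • b i⟫ := by
      rw [b.orthonormal.inner_right_fintype]
    rw [e1, Real.dist_eq, e2]
    refine (abs_real_inner_le_norm _ _).trans ?_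
    rw [b.orthonormal.1 i, one_mul]
  have h1 := hL.le_hausdorffMeasure_image (d := n) (by positivity) (Metric.closedBall 0 ρ)
  have h2 : (μH[(n:ℝ)] : Measure (Fin n → ℝ)) = volume := by
    simpa using hausdorffMeasure_pi_real (ι := Fin n)
  rw [h2, Real.volume_pi_closedBall _ hρ] at h1
  simp only [Fintype.card_fin, ENNReal.coe_one, ENNReal.one_rpow, one_mul] at h1
  refine h1.trans (measure_mono ?_)
  rintro _ ⟨a, ha, rfl⟩
  have ha' : ∀ i, |a i| ≤ ρ := by
    intro i
    rw [mem_closedBall_zero_iff] at ha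
    exact (norm_le_pi_norm a i).trans ha
  constructor
  · simp only [L, inner_add_left, Submodule.coe_sum, sum_inner, Submodule.coe_smul, real_inner_smul_left, hb, mul_zero, Finset.sum_const_zero, real_inner_self_eq_norm_sq]
    field_simp
    ring
  · refine (norm_add_le _ _).trans (le_trans (add_le_add ?_ ?_) h)
    · rw [norm_smul, Real.norm_eq_abs, abs_div, abs_norm, div_mul_cancel₀ _ hw']
    · rw [← Submodule.coe_norm]
      refine (norm_sum_le _ _).trans ?_
      calc _ ≤ ∑ i : Fin n, ρ := Finset.sum_le_sum (fun i _ => by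
            rw [norm_smul, b.orthonormal.1 i, mul_one]; exact ha' i)
        _ = _ := by simp

theorem exists_dir (n : ℕ) (hn : 1 ≤ n) (v : EuclideanSpace ℝ (Fin (n+1))) (c : ℝ) (hc : 0 ≤ c) (h : c ≤ ‖v‖) :
    ∃ e : EuclideanSpace ℝ (Fin (n+1)), ‖e‖ = 1 ∧ ⟪v, e⟫ = c := by
  haveI : Fact (Module.finrank ℝ (EuclideanSpace ℝ (Fin (n+1))) = n + 1) := ⟨by simp⟩
  by_cases hv : v = 0
  · subst hv
    obtain ⟨e, he⟩ := exists_norm_eq (EuclideanSpace ℝ (Fin (n+1))) (c := 1) (by norm_num)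
    refine ⟨e, he, ?_⟩
    simp at h ⊢
    linarith
  · let b := OrthonormalBasis.fromOrthogonalSpanSingleton (𝕜 := ℝ) n hv
    let f : EuclideanSpace ℝ (Fin (n+1)) := b ⟨0, hn⟩
    have hf : ‖f‖ = 1 := b.orthonormal.1 _
    have hvf : ⟪v, f⟫ = 0 := Submodule.mem_orthogonal_singleton_iff_inner_right.1 (b ⟨0, hn⟩).2
    have hr : 0 < ‖v‖ := norm_pos_iff.2 hv
    have hcr : 0 ≤ 1 - (c/‖v‖)^2 := by
      have : c / ‖v‖ ≤ 1 := (div_le_one hr).2 h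
      have : 0 ≤ c / ‖v‖ := by positivity
      nlinarith
    refine ⟨(c/‖v‖^2) • v + Real.sqrt (1 - (c/‖v‖)^2) • f, ?_, ?_⟩
    · rw [← sq_eq_sq₀ (norm_nonneg _) zero_le_one, norm_add_sq_real, norm_smul, norm_smul,
        real_inner_smul_left, real_inner_smul_right, hvf, hf, mul_pow, mul_pow, Real.norm_eq_abs, Real.norm_eq_abs, sq_abs, sq_abs, Real.sq_sqrt hcr]
      field_simp
      ring
    · rw [inner_add_right, real_inner_smul_right, real_inner_smul_right, hvf, real_inner_self_eq_norm_sq]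
      field_simp
      ring

theorem exists_pt (n : ℕ) (hn : 1 ≤ n) (β : ℝ) (hβ : β ∈ Set.Ioo (1/2 : ℝ) 1)
    (v : EuclideanSpace ℝ (Fin (n+1))) (hv : ‖v‖ ≤ Real.sqrt (1 + β^2)) :
    ∃ u : EuclideanSpace ℝ (Fin (n+1)), ‖u‖ < 1 ∧
      |⟪v, u - v⟫ + (1/β - 1) * ‖u - v‖^2 * (-1)| < ‖u - v‖ := by
  obtain ⟨h1, h2⟩ := hβ
  have key : ∃ p c : ℝ, 0 < p ∧ 0 ≤ c ∧ c ≤ ‖v‖ ∧ ‖v‖^2 - 2*p*c + p^2 < 1 ∧ c + (1/β-1) * p < 1 := by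
    have hg : 0 < 1/β - 1 := by
      rw [sub_pos, lt_div_iff₀ (by linarith)]; linarith
    have hg1 : 1/β - 1 < 1 := by
      rw [sub_lt_iff_lt_add, div_lt_iff₀ (by linarith)]; linarith
    rcases lt_or_ge ‖v‖ 1 with hr | hr
    · have h0 := norm_nonneg v
      have hp : 0 < (1 - ‖v‖) / 2 := by linarith
      refine ⟨(1 - ‖v‖) / 2, 0, hp, le_rfl, h0, by nlinarith, by nlinarith⟩
    · have hb : 0 < 2 - β := by linarith
      have hsq : ‖v‖^2 ≤ 1 + β^2 := by
        rw [← Real.sq_sqrt (show 0 ≤ 1 + β^2 by positivity)]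
        gcongr
      have hlt : (β*(2-β) + β/(2-β))/2 < 1/(2-β) := by
        rw [div_lt_iff₀ (by norm_num), ← sub_pos]
        have : 1/(2-β)*2 - (β*(2-β) + β/(2-β)) = (1-β)^2 := by
          field_simp; ring
        rw [this]; nlinarith
      obtain ⟨c, hc1, hc2⟩ := exists_between hlt
      have hc0 : 0 ≤ c := le_trans (by positivity) hc1.le
      refine ⟨β/(2-β), c, by positivity, hc0, ?_, ?_, ?_⟩
      · have : 1/(2-β) ≤ 1 := by rw [div_le_one hb]; linarith
        linarith
      · have hp : 0 < β/(2-β) := by positivity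
        have : β/(2-β) * (2-β) = β := by field_simp
        nlinarith
      · have : (1/β-1) * (β/(2-β)) = 1 - 1/(2-β) := by field_simp; ring
        linarith
  obtain ⟨p, c, hp, hc, hcv, k1, k2⟩ := key
  obtain ⟨e, he, hve⟩ := exists_dir n hn v c hc hcv
  have hw : v - p • e - v = -(p • e) := by abel
  refine ⟨v - p • e, ?_, ?_⟩
  · rw [← sq_lt_one_iff₀ (norm_nonneg _), norm_sub_sq_real, real_inner_smul_right, norm_smul, hve, he, Real.norm_eq_abs, mul_pow, sq_abs]
    linarith
  · have hg : 0 < 1/β - 1 := by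
      rw [sub_pos, lt_div_iff₀ (by linarith)]; linarith
    rw [hw, norm_neg, norm_smul, inner_neg_right, real_inner_smul_right, hve, he, Real.norm_eq_abs, abs_of_pos hp,
      show -(p*c) + (1/β-1) * (p*1)^2 * (-1) = - (p * (c + (1/β-1)*p)) by ring, abs_neg, abs_of_nonneg (by positivity)]
    gcongr

theorem unif (n : ℕ) (hn : 1 ≤ n) (β : ℝ) (hβ : β ∈ Set.Ioo (1/2 : ℝ) 1) :
    ∃ δ : ℝ, 0 < δ ∧ ∀ v ∈ Metric.closedBall (0 : EuclideanSpace ℝ (Fin (n+1))) (Real.sqrt (1 + β^2)),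
      ∃ u₀ : EuclideanSpace ℝ (Fin (n+1)), ∀ u ∈ Metric.ball u₀ δ, ‖u‖ < 1 ∧
      |⟪v, u - v⟫ + (1/β - 1) * ‖u - v‖^2 * (-1)| < (1 - δ) * ‖u - v‖ := by
  refine (isCompact_closedBall (0 : EuclideanSpace ℝ (Fin (n+1))) (Real.sqrt (1 + β^2))).induction_on
    (p := fun S => ∃ δ : ℝ, 0 < δ ∧ ∀ v ∈ S,
      ∃ u₀ : EuclideanSpace ℝ (Fin (n+1)), ∀ u ∈ Metric.ball u₀ δ, ‖u‖ < 1 ∧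
      |⟪v, u - v⟫ + (1/β - 1) * ‖u - v‖^2 * (-1)| < (1 - δ) * ‖u - v‖) ?_ ?_ ?_ ?_
  · exact ⟨1, one_pos, by simp⟩
  · rintro s t hst ⟨δ, h0, h⟩
    exact ⟨δ, h0, fun v hv => h v (hst hv)⟩
  · have mono : ∀ δ δ' : ℝ, δ' ≤ δ → ∀ v : EuclideanSpace ℝ (Fin (n+1)), (∃ u₀ : EuclideanSpace ℝ (Fin (n+1)), ∀ u ∈ Metric.ball u₀ δ, ‖u‖ < 1 ∧
      |⟪v, u - v⟫ + (1/β - 1) * ‖u - v‖^2 * (-1)| < (1 - δ) * ‖u - v‖) → (∃ u₀ : EuclideanSpace ℝ (Fin (n+1)), ∀ u ∈ Metric.ball u₀ δ', ‖u‖ < 1 ∧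
      |⟪v, u - v⟫ + (1/β - 1) * ‖u - v‖^2 * (-1)| < (1 - δ') * ‖u - v‖) := by
      rintro δ δ' hd v ⟨u₀, h⟩
      refine ⟨u₀, fun u hu => ?_⟩
      obtain ⟨a, b⟩ := h u (Metric.ball_subset_ball hd hu)
      exact ⟨a, b.trans_le (by gcongr)⟩
    rintro s t ⟨δ, h0, h⟩ ⟨δ', h0', h'⟩
    refine ⟨min δ δ', lt_min h0 h0', ?_⟩
    rintro v (hv | hv)
    · exact mono _ _ (min_le_left _ _) v (h v hv)
    · exact mono _ _ (min_le_right _ _) v (h' v hv)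
  · intro v hv
    obtain ⟨u₀, hu, hlt⟩ := exists_pt n hn β hβ v (by simpa using hv)
    let O : Set (ℝ × EuclideanSpace ℝ (Fin (n+1)) × EuclideanSpace ℝ (Fin (n+1))) :=
      {q | ‖q.2.2‖ < 1} ∩ {q | |⟪q.2.1, q.2.2 - q.2.1⟫ + (1/β - 1) * ‖q.2.2 - q.2.1‖^2 * (-1)| < (1 - q.1) * ‖q.2.2 - q.2.1‖}
    have hO : IsOpen O := by
      refine (isOpen_lt (by fun_prop) (by fun_prop)).inter (isOpen_lt (by fun_prop) (by fun_prop))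
    have hm : ((0:ℝ), v, u₀) ∈ O := ⟨hu, by simpa using hlt⟩
    obtain ⟨η, hη, hs⟩ := Metric.isOpen_iff.1 hO _ hm
    refine ⟨Metric.ball v η, mem_nhdsWithin_of_mem_nhds (Metric.ball_mem_nhds _ hη), η/2, by positivity, ?_⟩
    intro v' hv'
    refine ⟨u₀, fun u hu' => ?_⟩
    have : ((η/2:ℝ), v', u) ∈ O := by
      apply hs
      rw [Metric.mem_ball, Prod.dist_eq, Prod.dist_eq, max_lt_iff, max_lt_iff]
      refine ⟨?_, hv', ?_⟩
      · simp [abs_of_pos hη, hη]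
      · exact lt_trans hu' (by simpa using hη)
    exact this

theorem inelastic_region_estimate (d : ℕ) (hd : 2 ≤ d)
    (β : ℝ) (hβ : β ∈ Set.Ioo (1/2 : ℝ) 1) :
    ∃ C : ℝ, 0 < C ∧ ∀ R : ℝ, 0 < R →
      ∀ ε : ℝ, ε ∈ Set.Ioo 0 (1 - 1 / Real.sqrt (1 + β^2)) →
      ∀ v : EuclideanSpace ℝ (Fin d), ‖v‖ ≤ Real.sqrt (1 + β^2) * (1 - ε) * R →
        ENNReal.ofReal (C * R ^ (2*d - 1) * ε ^ d) ≤
          ∫⁻ u in Metric.ball (0 : EuclideanSpace ℝ (Fin d)) R,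
            μH[(d:ℝ) - 1] {vs : EuclideanSpace ℝ (Fin d) |
              ⟪vs - ((1/β) • v - (1/β - 1) • u), u - v⟫ = 0 ∧ ‖vs‖ ≤ R} := by
  obtain ⟨n, rfl⟩ : ∃ n, d = n + 1 := ⟨d - 1, by omega⟩
  have hn : 1 ≤ n := by omega
  have hn0 : (0:ℝ) < n := by exact_mod_cast hn
  obtain ⟨δ, hδ, H⟩ := unif n hn β hβ
  let k : ℝ := (volume (Metric.ball (0 : EuclideanSpace ℝ (Fin (n+1))) 1)).toReal
  have hkE : ENNReal.ofReal k = volume (Metric.ball (0 : EuclideanSpace ℝ (Fin (n+1))) 1) :=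
    ENNReal.ofReal_toReal measure_ball_lt_top.ne
  have hk : 0 < k := ENNReal.toReal_pos (Metric.measure_ball_pos _ _ one_pos).ne' measure_ball_lt_top.ne
  refine ⟨(2 * (δ / n)) ^ n * (δ^(n+1) * k), by positivity, ?_⟩
  intro R hR ε hε v hv
  obtain ⟨hε0, hε1⟩ := hε
  have hε2 : ε ≤ 1 := hε1.le.trans (by
    have : 0 ≤ 1 / Real.sqrt (1 + β^2) := by positivity
    linarith)
  have hv' : R⁻¹ • v ∈ Metric.closedBall (0 : EuclideanSpace ℝ (Fin (n+1))) (Real.sqrt (1 + β^2)) := by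
    rw [mem_closedBall_zero_iff, norm_smul, Real.norm_eq_abs, abs_of_pos (inv_pos.2 hR), inv_mul_le_iff₀ hR]
    refine hv.trans ?_
    have hs : 0 ≤ Real.sqrt (1 + β^2) := by positivity
    have : Real.sqrt (1 + β^2) * (1 - ε) ≤ Real.sqrt (1 + β^2) * 1 := by
      gcongr; linarith
    nlinarith
  obtain ⟨u₀, hu₀⟩ := H _ hv'
  have hmain : ∀ u ∈ Metric.ball (R • u₀) (R * δ), u ∈ Metric.ball (0 : EuclideanSpace ℝ (Fin (n+1))) R ∧
      ENNReal.ofReal ((2 * (R * (δ / n))) ^ n) ≤ μH[((n+1:ℕ):ℝ) - 1] {vs : EuclideanSpace ℝ (Fin (n+1)) |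
              ⟪vs - ((1/β) • v - (1/β - 1) • u), u - v⟫ = 0 ∧ ‖vs‖ ≤ R} := by
    intro u hu
    obtain ⟨x, rfl⟩ : ∃ x, u = R • x := ⟨R⁻¹ • u, by rw [smul_inv_smul₀ hR.ne']⟩
    obtain ⟨y, rfl⟩ : ∃ y, v = R • y := ⟨R⁻¹ • v, by rw [smul_inv_smul₀ hR.ne']⟩
    rw [inv_smul_smul₀ hR.ne'] at hu₀
    have hx : x ∈ Metric.ball u₀ δ := by
      rw [Metric.mem_ball, dist_smul₀, Real.norm_eq_abs, abs_of_pos hR] at hu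
      exact lt_of_mul_lt_mul_left hu hR.le
    obtain ⟨a, b⟩ := hu₀ x hx
    constructor
    · rw [mem_ball_zero_iff, norm_smul, Real.norm_eq_abs, abs_of_pos hR]
      nlinarith
    · have hw : x - y ≠ 0 := by
        intro h0
        rw [h0] at b
        simp at b
      have hw' : 0 < ‖x - y‖ := norm_pos_iff.2 hw
      set t : ℝ := R * ((⟪y, x - y⟫ + (1/β - 1) * ‖x - y‖^2 * (-1)) / ‖x - y‖) with ht
      have htb : |t| ≤ R * (1 - δ) := by
        rw [ht, abs_mul, abs_of_pos hR, abs_div, abs_norm]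
        gcongr
        rw [div_le_iff₀ hw']
        exact b.le
      have := slice_lb n (x - y) hw t R (R * (δ / n)) (by positivity) (by
        have : n * (R * (δ / n)) = R * δ := by field_simp
        rw [this]; linarith)
      refine this.trans ?_
      rw [show ((n+1:ℕ):ℝ) - 1 = n by push_cast; ring]
      refine measure_mono ?_
      rintro z ⟨hz, hzR⟩
      refine ⟨?_, hzR⟩
      have e1 : z - ((1/β) • (R • y) - (1/β - 1) • (R • x)) = z - R • y + (R * (1/β-1)) • (x - y) := by
        module
      have e2 : t * ‖x - y‖ = R * (⟪y, x - y⟫ + (1/β - 1) * ‖x - y‖^2 * (-1)) := by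
        rw [ht]; field_simp
      rw [e1, ← smul_sub, real_inner_smul_right, inner_add_left, inner_sub_left, hz, e2,
        real_inner_smul_left, real_inner_smul_left, real_inner_self_eq_norm_sq]
      ring
  calc ENNReal.ofReal ((2 * (δ / n)) ^ n * (δ^(n+1) * k) * R ^ (2*(n+1) - 1) * ε ^ (n+1))
      ≤ ENNReal.ofReal ((2 * (R * (δ / n))) ^ n * ((R * δ)^(n+1) * k)) := by
        apply ENNReal.ofReal_le_ofReal
        rw [show 2*(n+1) - 1 = n + (n+1) by omega]
        have : (2 * (R * (δ / n))) ^ n * ((R * δ)^(n+1) * k) = (2 * (δ / n)) ^ n * (δ^(n+1) * k) * R ^ (n + (n+1)) * 1 := by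
          rw [show 2 * (R * (δ / n)) = R * (2 * (δ / n)) by ring, mul_pow, mul_pow, pow_add]
          ring
        rw [this]
        gcongr
        exact pow_le_one₀ hε0.le hε2
    _ = ENNReal.ofReal ((2 * (R * (δ / n))) ^ n) * volume (Metric.ball (R • u₀) (R * δ)) := by
        rw [Measure.addHaar_ball _ _ (by positivity), ← hkE, ENNReal.ofReal_mul (by positivity), ENNReal.ofReal_mul (by positivity)]
        simp
    _ = ∫⁻ u in Metric.ball (R • u₀) (R * δ), ENNReal.ofReal ((2 * (R * (δ / n))) ^ n) := by
        rw [setLIntegral_const]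
    _ ≤ ∫⁻ u in Metric.ball (R • u₀) (R * δ), _ :=
        setLIntegral_mono' measurableSet_ball (fun u hu => (hmain u hu).2)
    _ ≤ _ := lintegral_mono_set (fun u hu => (hmain u hu).1)
end
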